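/- Suppose k, f, s satisfy (i) k' = k^2 − k·f, (ii) s' = 2·k·s and (iii) f' = f^2 − k·f + 4·s^2 at every point of I, that k(t) ≠ 0 for every t ∈ I, and that −9·k^4 + 19·f·k^3 + (164·s^2 − 9·f^2)·k^2 − 120·s^2·f·k − 32·s^4 = 0 at every point of I. Then −18·k^4 + 37·f·k^3 + (−19·f^2 + 530·s^2)·k^2 − 440·s^2·f·k − 368·s^4 = 0 at every point of I. -/

import Mathlib

/-- Differentiating the quartic relation
`−9·k⁴ + 19·f·k³ + (164·s² − 9·f²)·k² − 120·s²·f·k − 32·s⁴ = 0` along the flow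
(using the structure equations (i)–(iii) and `k ≠ 0`) yields
`−18·k⁴ + 37·f·k³ + (−19·f² + 530·s²)·k² − 440·s²·f·k − 368·s⁴ = 0`. -/
theorem deriv_quartic_relation
    (a b : ℝ) (hab : a < b) (I : Set ℝ) (hI : I = Set.Ioo a b)
    (k f s : ℝ → ℝ) (hk : ContDiff ℝ (⊤ : ℕ∞) k) (hf : ContDiff ℝ (⊤ : ℕ∞) f)
    (hs : ContDiff ℝ (⊤ : ℕ∞) s) (c : ℝ)
    (h1 : ∀ t ∈ I, deriv k t = k t ^ 2 - k t * f t)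
    (h2 : ∀ t ∈ I, deriv s t = 2 * k t * s t)
    (h3 : ∀ t ∈ I, deriv f t = f t ^ 2 - k t * f t + 4 * s t ^ 2)
    (hk0 : ∀ t ∈ I, k t ≠ 0)
    (hrel : ∀ t ∈ I,
      -9 * k t ^ 4 + 19 * f t * k t ^ 3 + (164 * s t ^ 2 - 9 * f t ^ 2) * k t ^ 2
        - 120 * s t ^ 2 * f t * k t - 32 * s t ^ 4 = 0) :
    ∀ t ∈ I,
      -18 * k t ^ 4 + 37 * f t * k t ^ 3 + (-19 * f t ^ 2 + 530 * s t ^ 2) * k t ^ 2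
        - 440 * s t ^ 2 * f t * k t - 368 * s t ^ 4 = 0 := by
  subst hI
  intro t ht
  have hasDeriv {g : ℝ → ℝ} (hg : ContDiff ℝ (⊤ : ℕ∞) g) : HasDerivAt g (deriv g t) t :=
    (hg.differentiable (by simp) t).hasDerivAt
  have dk := hasDeriv hk
  have df := hasDeriv hf
  have ds := hasDeriv hs
  rw [h1 t ht] at dk
  rw [h2 t ht] at ds
  rw [h3 t ht] at df
  have hderiv := ((((dk.pow 4).const_mul (-9)).add ((df.const_mul 19).mul (dk.pow 3))).add
    ((((ds.pow 2).const_mul 164).sub ((df.pow 2).const_mul 9)).mul (dk.pow 2))).sub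
    ((((ds.pow 2).const_mul 120).mul df).mul dk) |>.sub ((ds.pow 4).const_mul 32)
  have hzero := (hasDerivAt_const t (0 : ℝ)).congr_of_eventuallyEq
    (Filter.eventuallyEq_of_mem (isOpen_Ioo.mem_nhds ht) hrel)
  have heq := hderiv.unique hzero
  simp only [Pi.mul_apply, Pi.pow_apply, Pi.sub_apply] at heq
  refine (mul_eq_zero.mp ?_).resolve_left (mul_ne_zero two_ne_zero (hk0 t ht))
  linear_combination heq
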